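/- arXiv:math/0608049 — 8 statements merged into one kernel-verified Lean document; each statement's English description precedes it below -/
import Mathlib

section
/- The sequence (l_n) is strictly increasing in n: for every natural number n ≥ 1, if l_n > 0 satisfies sinh(l_n/(2n)) · sinh(l_n/2) = 1 and l_{n+1} > 0 satisfies sinh(l_{n+1}/(2n+2)) · sinh(l_{n+1}/2) = 1, then l_n < l_{n+1}. -/
/-- The sequence `l_n` is strictly increasing: if `l > 0` solves
`sinh (l / (2 n)) * sinh (l / 2) = 1` and `l' > 0` solves
`sinh (l' / (2 n + 2)) * sinh (l' / 2) = 1`, then `l < l'`. -/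
theorem l_n_strictMono (n : ℕ) (hn : 1 ≤ n) (l l' : ℝ) (hl : 0 < l) (hl' : 0 < l')
    (h : Real.sinh (l / (2 * n)) * Real.sinh (l / 2) = 1)
    (h' : Real.sinh (l' / (2 * n + 2)) * Real.sinh (l' / 2) = 1) :
    l < l' := by
  by_contra! hle
  have hn0 : (0 : ℝ) < n := by exact_mod_cast hn
  have hlt : l' / (2 * n + 2) < l / (2 * n) :=
    div_lt_div₀' hle (by linarith) hl (by linarith)
  have hprod : Real.sinh (l' / (2 * n + 2)) * Real.sinh (l' / 2)
      < Real.sinh (l / (2 * n)) * Real.sinh (l / 2) :=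
    mul_lt_mul (Real.sinh_lt_sinh.2 hlt) (Real.sinh_le_sinh.2 (by linarith))
      (Real.sinh_pos_iff.2 (by linarith)) (Real.sinh_nonneg_iff.2 (by positivity))
  linarith
end

section
/- For every natural number n ≥ 1 and every real x > 0, max(x, 2n · arcsinh(1/sinh(x/2))) ≥ l_n, where l_n is the unique positive real satisfying sinh(l_n/(2n)) · sinh(l_n/2) = 1. (This is the analytic content of the collar-theorem lower bound l_n ≤ L_n: if a simple closed geodesic of length x is crossed n times by another geodesic, the second has length at least 2n · arcsinh(1/sinh(x/2)), so the longer of the two has length at least l_n.) -/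
/-- For `n ≥ 1` and `x > 0`, `max (x, 2 n · arsinh (1 / sinh (x/2))) ≥ l_n`, where `l_n`
is the unique positive real with `sinh (l_n / (2 n)) * sinh (l_n / 2) = 1`. -/
theorem max_ge_l_n (n : ℕ) (hn : 1 ≤ n) (x : ℝ) (hx : 0 < x) (l : ℝ) (hl : 0 < l)
    (hsol : Real.sinh (l / (2 * n)) * Real.sinh (l / 2) = 1) :
    l ≤ max x (2 * n * Real.arsinh (1 / Real.sinh (x / 2))) := by
  rcases le_total l x with h | h
  · exact le_max_of_le_left h
  · apply le_max_of_le_right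
    have hn' : (0 : ℝ) < 2 * n := by
      have : (0 : ℝ) < n := by exact_mod_cast hn
      positivity
    have hsx : 0 < Real.sinh (x / 2) := Real.sinh_pos_iff.2 (by positivity)
    have hsn : 0 < Real.sinh (l / (2 * n)) := Real.sinh_pos_iff.2 (by positivity)
    have hmono : Real.sinh (x / 2) ≤ Real.sinh (l / 2) := Real.sinh_le_sinh.2 (by linarith)
    have hle : Real.sinh (l / (2 * n)) ≤ 1 / Real.sinh (x / 2) := by
      rw [le_div_iff₀ hsx, ← hsol]
      gcongr
    have key : l / (2 * n) ≤ Real.arsinh (1 / Real.sinh (x / 2)) := by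
      rw [← Real.arsinh_sinh (l / (2 * n))]
      exact Real.arsinh_le_arsinh.2 hle
    rwa [div_le_iff₀' hn'] at key
end

section
/- Let α, a, β be positive reals and ε ≥ 0 a real satisfying the two hyperbolic-polygon relations sinh(β/4) = sinh(a/2) · cosh(α/4) and sinh(a/2) · sinh(α/2) = cosh(ε/4). Then cosh(β/2) = 1 + (cosh(ε/2) + 1) / (2(cosh(α/2) − 1)). -/
/-- From the quadrilateral relation `sinh (β/4) = sinh (a/2) cosh (α/4)` and the pentagon
relation `sinh (a/2) sinh (α/2) = cosh (ε/4)`, it follows that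
`cosh (β/2) = 1 + (cosh (ε/2) + 1) / (2 (cosh (α/2) − 1))`. -/
theorem cosh_half_beta (α a β ε : ℝ) (hα : 0 < α) (ha : 0 < a) (hβ : 0 < β) (hε : 0 ≤ ε)
    (h1 : Real.sinh (β / 4) = Real.sinh (a / 2) * Real.cosh (α / 4))
    (h2 : Real.sinh (a / 2) * Real.sinh (α / 2) = Real.cosh (ε / 4)) :
    Real.cosh (β / 2) = 1 + (Real.cosh (ε / 2) + 1) / (2 * (Real.cosh (α / 2) - 1)) := by
  have hS : Real.sinh (α / 4) ≠ 0 := (Real.sinh_pos_iff.2 (by positivity)).ne'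
  have cosh_half (x : ℝ) : Real.cosh (x / 2) = 1 + 2 * Real.sinh (x / 4) ^ 2 := by
    rw [show x / 2 = 2 * (x / 4) by ring, Real.cosh_two_mul, Real.cosh_sq]
    ring
  have hα2 : Real.sinh (α / 2) = 2 * Real.sinh (α / 4) * Real.cosh (α / 4) := by
    rw [show α / 2 = 2 * (α / 4) by ring, Real.sinh_two_mul]
  have hε2 : Real.cosh (ε / 2) + 1 = 2 * Real.cosh (ε / 4) ^ 2 := by
    rw [cosh_half, Real.cosh_sq]
    ring
  rw [hε2, cosh_half β, cosh_half α, h1, ← h2, hα2, add_sub_cancel_left]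
  field_simp
end

section
/- For every real α > 0, max(α, 2 · arccosh(1 + 1/(cosh(α/2) − 1))) ≥ 2 · arccosh 2, and equality holds if and only if α = 2 · arccosh 2. (This is the analytic content of Corollary 3.5: on a once-punctured torus, the shortest geodesic crossing a geodesic of length α twice has length 2 · arccosh(1 + 1/(cosh(α/2) − 1)), so the longer of the two geodesics has length at least L_2 = 2 · arccosh 2.) -/
/-- For `y ≥ 1`, `arccosh y` is the unique `x ≥ 0` with `cosh x = y`. -/
noncomputable def arccosh (y : ℝ) : ℝ := Real.log (y + Real.sqrt (y ^ 2 - 1))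

theorem arccosh_eq_arcosh (y : ℝ) : arccosh y = Real.arcosh y := rfl

/-- For every `α > 0`, `max (α, 2 arccosh (1 + 1 / (cosh (α/2) − 1))) ≥ 2 arccosh 2`,
with equality iff `α = 2 arccosh 2`. -/
theorem max_ge_L2 (α : ℝ) (hα : 0 < α) :
    2 * arccosh 2 ≤ max α (2 * arccosh (1 + 1 / (Real.cosh (α / 2) - 1))) ∧
    (max α (2 * arccosh (1 + 1 / (Real.cosh (α / 2) - 1))) = 2 * arccosh 2 ↔
      α = 2 * arccosh 2) := by
  simp only [arccosh_eq_arcosh]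
  set c := Real.cosh (α / 2) with hc
  have one_lt_c : 1 < c := Real.one_lt_cosh.2 (by positivity)
  have c_sub_pos : 0 < c - 1 := by linarith
  have α_eq : α = 2 * Real.arcosh c := by
    rw [hc, Real.arcosh_cosh (by positivity)]; ring
  have dual_pos : 0 < 1 + 1 / (c - 1) := by positivity
  rcases lt_trichotomy c 2 with h | h | h
  · have two_lt : 2 < 1 + 1 / (c - 1) := by
      have := (one_lt_div c_sub_pos).2 (by linarith : c - 1 < 1)
      linarith
    have lt_dual := (Real.arcosh_lt_arcosh two_pos dual_pos).2 two_lt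
    have α_lt := (Real.arcosh_lt_arcosh (by linarith) two_pos).2 h
    have lt_max := lt_max_of_lt_right (b := α) (mul_lt_mul_of_pos_left lt_dual two_pos)
    exact ⟨lt_max.le, fun e => absurd e lt_max.ne', fun e => by linarith⟩
  · have dual_eq : 1 + 1 / (c - 1) = 2 := by rw [h]; norm_num
    rw [dual_eq, α_eq, h]
    simp
  · have lt_α : 2 * Real.arcosh 2 < α := by
      linarith [(Real.arcosh_lt_arcosh two_pos (by linarith)).2 h]
    have lt_max := lt_max_of_lt_left (c := 2 * Real.arcosh (1 + 1 / (c - 1))) lt_α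
    exact ⟨lt_max.le, fun e => absurd e lt_max.ne', fun e => absurd e lt_α.ne'⟩
end

section
/- For every real x with 0 < x ≤ 2 · arccosh 2, one has 4 · arcsinh(1/sinh(x/2)) + 4 · arcsinh(1/sinh(x)) > 2 · arccosh 2. (This inequality rules out a twice-punctured torus as the minimizing surface S_2: if α has length x ≤ 2 · arccosh 2 and δ has length less than 2x, then a geodesic β crossing each of the disjoint geodesics α and δ twice has length at least 4w(α) + 4w(δ), which exceeds 2 · arccosh 2.) -/
/-- The hyperbolic sine of `arccosh 2` is `√3`. -/
theorem sinh_arccosh_two : Real.sinh (arccosh 2) = √3 := by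
  change Real.sinh (Real.arcosh 2) = √3
  rw [Real.sinh_arcosh (by norm_num)]
  norm_num

/-- The hyperbolic sine of `2 * arccosh 2` is `4 * √3`. -/
theorem sinh_two_mul_arccosh_two : Real.sinh (2 * arccosh 2) = 4 * √3 := by
  have hcosh : Real.cosh (arccosh 2) = 2 := Real.cosh_arcosh (by norm_num)
  rw [Real.sinh_two_mul, hcosh, sinh_arccosh_two]
  ring

/-- The collar widths at lengths `2 * arccosh 2` and `4 * arccosh 2` add up to `log 2`. -/
theorem arsinh_add_arsinh_eq_log_two :
    Real.arsinh (1 / √3) + Real.arsinh (1 / (4 * √3)) = Real.log 2 := by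
  have hpos : 0 < √3 := by positivity
  have hsq : √3 ^ 2 = 3 := Real.sq_sqrt (by norm_num)
  have hroot₁ : √(1 + (1 / √3) ^ 2) = 2 / √3 := by
    rw [Real.sqrt_eq_iff_mul_self_eq_of_pos (by positivity)]
    field_simp
    linarith
  have hroot₂ : √(1 + (1 / (4 * √3)) ^ 2) = 7 / (4 * √3) := by
    rw [Real.sqrt_eq_iff_mul_self_eq_of_pos (by positivity)]
    field_simp
    linarith
  rw [Real.arsinh, Real.arsinh, hroot₁, hroot₂,
    ← Real.log_mul (by positivity) (by positivity)]
  congr 1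
  field_simp
  linarith

/-- `arccosh 2 = log (2 + √3)` is less than `2 * log 2 = log 4`. -/
theorem arccosh_two_lt_two_mul_log_two : arccosh 2 < 2 * Real.log 2 := by
  have hsqrt : √((2 : ℝ) ^ 2 - 1) < 2 := by
    rw [Real.sqrt_lt' (by norm_num)]
    norm_num
  calc arccosh 2 < Real.log (2 ^ 2) := Real.log_lt_log (by positivity) (by linarith)
    _ = 2 * Real.log 2 := by rw [Real.log_pow]; norm_num

/-- For `0 < x ≤ 2 arccosh 2`, one has
`4 arsinh (1 / sinh (x/2)) + 4 arsinh (1 / sinh x) > 2 arccosh 2`. -/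
theorem collar_sum_gt_L2 (x : ℝ) (hx : 0 < x) (hx2 : x ≤ 2 * arccosh 2) :
    2 * arccosh 2 <
      4 * Real.arsinh (1 / Real.sinh (x / 2)) + 4 * Real.arsinh (1 / Real.sinh x) := by
  have hhalf : Real.arsinh (1 / √3) ≤ Real.arsinh (1 / Real.sinh (x / 2)) := by
    rw [Real.arsinh_le_arsinh, ← sinh_arccosh_two]
    exact one_div_le_one_div_of_le (Real.sinh_pos_iff.2 (by linarith))
      (Real.sinh_le_sinh.2 (by linarith))
  have hfull : Real.arsinh (1 / (4 * √3)) ≤ Real.arsinh (1 / Real.sinh x) := by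
    rw [Real.arsinh_le_arsinh, ← sinh_two_mul_arccosh_two]
    exact one_div_le_one_div_of_le (Real.sinh_pos_iff.2 hx) (Real.sinh_le_sinh.2 hx2)
  linarith [arsinh_add_arsinh_eq_log_two, arccosh_two_lt_two_mul_log_two]
end

section
/- Let r, s, t be real numbers with 1 < r ≤ s ≤ t ≤ rs and r² + s² + t² = 2rst. Then (2rt − s)² ≥ (7 + (11/3)·√(11/3))/2, with equality if and only if r = (3 + √(11/3))/4 and s = t = √((13 + 7√(11/3))/8). -/
/-- Decomposition of `2(r - 1)((2rt - s)² - K)`, where `K` is the minimum, into terms that are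
nonnegative for `1 < r` and `0 < s ≤ t`. -/
lemma traces_decomposition (r s t q : ℝ) (hq : q ^ 2 = 11 / 3)
    (hrel : r ^ 2 + s ^ 2 + t ^ 2 = 2 * r * s * t) :
    2 * (r - 1) * ((2 * r * t - s) ^ 2 - (7 + 11 / 3 * q) / 2) =
      (r - (3 + q) / 4) ^ 2 * (4 * r ^ 2 + (2 + 2 * q) * r + (9 + 5 * q) / 2) +
      (2 * r - 1) ^ 2 * (t - s) ^ 2 +
      2 * (r - 1) * (t - s) * ((2 * r - 1) ^ 2 * t + ((4 * r - 1) * t - s)) := by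
  have hq3 : q ^ 3 = 11 / 3 * q := by rw [pow_succ, hq]
  ring_nf
  rw [hq3, hq]
  linear_combination (-(2 * r - 1) ^ 2) * hrel

/-- For `1 < r ≤ s ≤ t ≤ rs` with `r² + s² + t² = 2rst`, one has
`(2rt − s)² ≥ (7 + (11/3)√(11/3))/2`, with equality iff `r = (3 + √(11/3))/4` and
`s = t = √((13 + 7√(11/3))/8)`. -/
theorem traces_min (r s t : ℝ) (hr : 1 < r) (hrs : r ≤ s) (hst : s ≤ t) (htrs : t ≤ r * s)
    (hrel : r ^ 2 + s ^ 2 + t ^ 2 = 2 * r * s * t) :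
    (7 + 11 / 3 * Real.sqrt (11 / 3)) / 2 ≤ (2 * r * t - s) ^ 2 ∧
    ((2 * r * t - s) ^ 2 = (7 + 11 / 3 * Real.sqrt (11 / 3)) / 2 ↔
      r = (3 + Real.sqrt (11 / 3)) / 4 ∧
      s = Real.sqrt ((13 + 7 * Real.sqrt (11 / 3)) / 8) ∧
      t = Real.sqrt ((13 + 7 * Real.sqrt (11 / 3)) / 8)) := by
  have hq : √(11 / 3 : ℝ) ^ 2 = 11 / 3 := Real.sq_sqrt (by norm_num)
  have hq0 : 0 ≤ √(11 / 3 : ℝ) := Real.sqrt_nonneg _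
  generalize √(11 / 3 : ℝ) = q at hq hq0 ⊢
  have key := traces_decomposition r s t q hq hrel
  have ht : 0 < t := by linarith
  have hquad : 0 < 4 * r ^ 2 + (2 + 2 * q) * r + (9 + 5 * q) / 2 := by positivity
  have hlin : 0 < (2 * r - 1) ^ 2 * t + ((4 * r - 1) * t - s) := by
    nlinarith [mul_pos (sub_pos.2 hr) ht, mul_nonneg (sq_nonneg (2 * r - 1)) ht.le]
  have hts : 0 ≤ t - s := sub_nonneg.2 hst
  have hr1 : 0 < 2 * (r - 1) := by linarith
  have h₁ := mul_nonneg (sq_nonneg (r - (3 + q) / 4)) hquad.le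
  have h₂ := mul_nonneg (sq_nonneg (2 * r - 1)) (sq_nonneg (t - s))
  have h₃ := mul_nonneg (mul_nonneg hr1.le hts) hlin.le
  refine ⟨?_, fun h => ?_, ?_⟩
  · exact sub_nonneg.1 (nonneg_of_mul_nonneg_right (by linarith) hr1)
  · rw [h, sub_self, mul_zero] at key
    have hr0 : r = (3 + q) / 4 := by
      have h0 : (r - (3 + q) / 4) ^ 2 * (4 * r ^ 2 + (2 + 2 * q) * r + (9 + 5 * q) / 2) = 0 := by
        linarith
      exact sub_eq_zero.1 (pow_eq_zero_iff two_ne_zero |>.1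
        ((mul_eq_zero.1 h0).resolve_right hquad.ne'))
    have hst' : s = t := by
      have h0 : 2 * (r - 1) * (t - s) * ((2 * r - 1) ^ 2 * t + ((4 * r - 1) * t - s)) = 0 := by
        linarith
      have := (mul_eq_zero.1 ((mul_eq_zero.1 h0).resolve_right hlin.ne')).resolve_left hr1.ne'
      linarith
    subst hst'
    have hsq : s ^ 2 = (13 + 7 * q) / 8 := by
      refine mul_left_cancel₀ hr1.ne' ?_
      rw [hr0] at hrel ⊢
      linear_combination -hrel - 3 / 8 * hq
    have hs : s = √((13 + 7 * q) / 8) := by rw [← hsq, Real.sqrt_sq ht.le]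
    exact ⟨hr0, hs, hs⟩
  · rintro ⟨hr0, hs, ht'⟩
    have hst' : t = s := ht'.trans hs.symm
    rw [hst', hr0] at key
    have h0 : 2 * (r - 1) * ((2 * r * t - s) ^ 2 - (7 + 11 / 3 * q) / 2) = 0 := by
      rw [hst', hr0, key]; ring
    exact sub_eq_zero.1 ((mul_eq_zero.1 h0).resolve_left hr1.ne')
end

section
/- For every real r > 1, r²(2r − 1)²/(2(r − 1)) ≥ (7 + (11/3)·√(11/3))/2, with equality if and only if r = (3 + √(11/3))/4. -/
/-- The gap to the minimum has a double root at the minimizer and a positive cofactor. -/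
lemma f_gap_factorization {r s : ℝ} (hr : 1 < r) (hs : s ^ 2 = 11 / 3) :
    r ^ 2 * (2 * r - 1) ^ 2 / (2 * (r - 1)) - (7 + 11 / 3 * s) / 2 =
      (r - (3 + s) / 4) ^ 2 *
        ((4 * r ^ 2 + (2 + 2 * s) * r + (9 / 2 + 5 / 2 * s)) / (2 * (r - 1))) := by
  have hr' : r - 1 ≠ 0 := by linarith
  have key : r ^ 2 * (2 * r - 1) ^ 2 - (7 + 11 / 3 * s) * (r - 1) =
      (r - (3 + s) / 4) ^ 2 * (4 * r ^ 2 + (2 + 2 * s) * r + (9 / 2 + 5 / 2 * s)) := by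
    grind
  rw [mul_div_assoc', ← key]
  field_simp

/-- For every `r > 1`, `r²(2r−1)²/(2(r−1)) ≥ (7 + (11/3)√(11/3))/2`, with equality iff
`r = (3 + √(11/3))/4`. -/
theorem f_min (r : ℝ) (hr : 1 < r) :
    (7 + 11 / 3 * Real.sqrt (11 / 3)) / 2 ≤ r ^ 2 * (2 * r - 1) ^ 2 / (2 * (r - 1)) ∧
    (r ^ 2 * (2 * r - 1) ^ 2 / (2 * (r - 1)) = (7 + 11 / 3 * Real.sqrt (11 / 3)) / 2 ↔
      r = (3 + Real.sqrt (11 / 3)) / 4) := by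
  have gap := f_gap_factorization hr (Real.sq_sqrt (by norm_num : (0 : ℝ) ≤ 11 / 3))
  have hs := Real.sqrt_nonneg (11 / 3)
  set s := Real.sqrt (11 / 3)
  have hr₀ : 0 < r := by linarith
  have hr₁ : 0 < r - 1 := by linarith
  have hpos : 0 < (4 * r ^ 2 + (2 + 2 * s) * r + (9 / 2 + 5 / 2 * s)) / (2 * (r - 1)) := by
    positivity
  constructor
  · rw [← sub_nonneg, gap]
    positivity
  · rw [← sub_eq_zero, gap, mul_eq_zero_iff_right hpos.ne', sq_eq_zero_iff, sub_eq_zero]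
end

section
/- Let k₃ = 2 · arccosh√((7 + (11/3)·√(11/3))/2) and let m = 2 · arccosh(sinh(k₃/2) · sinh(k₃/2 − arcsinh(1/sinh(k₃/2)))). Then 6 · arcsinh(1/sinh(k₃/2)) + 6 · arcsinh(1/sinh(m/2)) > k₃. (This inequality rules out a twice-punctured torus as the minimizing surface S_3: if α and α′ are disjoint geodesics of lengths at most k₃ and at most m respectively, a geodesic β crossing each three times has length at least 6w(α) + 6w(α′) > k₃.) -/
theorem one_add_le_exp_arsinh (x : ℝ) : 1 + x ≤ Real.exp (Real.arsinh x) := by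
  rw [Real.exp_arsinh]
  have : 1 ≤ √(1 + x ^ 2) := Real.one_le_sqrt.2 (by nlinarith [sq_nonneg x])
  linarith

theorem cosh_arsinh_one_div_sinh {a : ℝ} (ha : 0 < a) :
    Real.cosh (Real.arsinh (1 / Real.sinh a)) = Real.cosh a / Real.sinh a := by
  have hs : 0 < Real.sinh a := Real.sinh_pos_iff.2 ha
  rw [Real.cosh_arsinh, Real.sqrt_eq_iff_eq_sq (by positivity)
    (div_nonneg (Real.cosh_pos a).le hs.le), div_pow, div_pow, Real.cosh_sq]
  field_simp

/-- With `k₃ = 2 arccosh √((7 + (11/3)√(11/3))/2)` and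
`m = 2 arccosh (sinh (k₃/2) sinh (k₃/2 − arsinh (1/sinh (k₃/2))))`, one has
`6 arsinh (1/sinh (k₃/2)) + 6 arsinh (1/sinh (m/2)) > k₃`. -/
theorem collar_sum_gt_k3 (k₃ m : ℝ)
    (hk : k₃ = 2 * arccosh (Real.sqrt ((7 + 11 / 3 * Real.sqrt (11 / 3)) / 2)))
    (hm : m = 2 * arccosh (Real.sinh (k₃ / 2) *
      Real.sinh (k₃ / 2 - Real.arsinh (1 / Real.sinh (k₃ / 2))))) :
    k₃ < 6 * Real.arsinh (1 / Real.sinh (k₃ / 2)) +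
      6 * Real.arsinh (1 / Real.sinh (m / 2)) := by
  obtain ⟨a, rfl⟩ : ∃ a, k₃ = 2 * a := ⟨k₃ / 2, by ring⟩
  obtain ⟨b, rfl⟩ : ∃ b, m = 2 * b := ⟨m / 2, by ring⟩
  simp only [mul_div_cancel_left₀ _ (two_ne_zero' ℝ), mul_right_inj' (two_ne_zero' ℝ),
    arccosh_eq_arcosh] at hk hm ⊢
  have hr₁ : 1.91 < √(11 / 3 : ℝ) := Real.lt_sqrt_of_sq_lt (by norm_num)
  have hr₂ : √(11 / 3 : ℝ) < 1.92 := (Real.sqrt_lt' (by norm_num)).2 (by norm_num)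
  have hc₁ : 2.64 < √((7 + 11 / 3 * √(11 / 3 : ℝ)) / 2) :=
    Real.lt_sqrt_of_sq_lt (by linarith)
  have hc₂ : √((7 + 11 / 3 * √(11 / 3 : ℝ)) / 2) < 2.66 :=
    (Real.sqrt_lt' (by norm_num)).2 (by linarith)
  have hcosh := Real.cosh_arcosh (by linarith : 1 ≤ √((7 + 11 / 3 * √(11 / 3 : ℝ)) / 2))
  have ha : 0 < a := hk ▸ Real.arcosh_pos (by linarith)
  rw [← hk] at hcosh
  rw [← hcosh] at hc₁ hc₂
  have hs : 0 < Real.sinh a := Real.sinh_pos_iff.2 ha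
  have hsq := Real.cosh_sq a
  have hs₁ : 2.44 < Real.sinh a := by nlinarith
  have hs₂ : Real.sinh a < 2.47 := by nlinarith
  have hw := cosh_arsinh_one_div_sinh ha
  have hY : Real.sinh a * Real.sinh (a - Real.arsinh (1 / Real.sinh a)) =
      Real.cosh a * (Real.sinh a - 1) := by
    rw [Real.sinh_sub, hw, Real.sinh_arsinh]
    field_simp
  rw [hY] at hm
  have hY₁ : 1 < Real.cosh a * (Real.sinh a - 1) := by nlinarith
  have hY₂ : Real.cosh a * (Real.sinh a - 1) < 4 := by nlinarith
  have hb : 0 < Real.sinh b := Real.sinh_pos_iff.2 (hm ▸ Real.arcosh_pos hY₁)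
  have hb₄ : Real.sinh b < 4 :=
    (Real.sinh_lt_cosh b).trans (by rwa [hm, Real.cosh_arcosh hY₁.le])
  have hew : 1.47 < Real.exp (Real.arsinh (1 / Real.sinh a)) := by
    rw [← Real.cosh_add_sinh, hw, Real.sinh_arsinh, ← add_div, lt_div_iff₀ hs]
    linarith
  have hew' : 1.25 < Real.exp (Real.arsinh (1 / Real.sinh b)) := by
    refine lt_of_lt_of_le ?_ (one_add_le_exp_arsinh _)
    have : 1 / 4 < 1 / Real.sinh b := one_div_lt_one_div_of_lt hb hb₄
    linarith
  suffices h : a < 3 * (Real.arsinh (1 / Real.sinh a) + Real.arsinh (1 / Real.sinh b)) by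
    linarith
  rw [← Real.exp_lt_exp]
  calc Real.exp a = Real.cosh a + Real.sinh a := (Real.cosh_add_sinh a).symm
    _ < (1.47 * 1.25) ^ 3 := by linarith
    _ < (Real.exp (Real.arsinh (1 / Real.sinh a)) *
          Real.exp (Real.arsinh (1 / Real.sinh b))) ^ 3 := by gcongr
    _ = _ := by rw [← Real.exp_add, ← Real.exp_nat_mul]; norm_num
end
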